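/- (Saito criterion for several polynomials) Let f_1,…,f_s ∈ R = k[x_1,…,x_n], with 1 < s ≤ n−1, be algebraically independent over the field k of characteristic zero, and let δ_1,…,δ_{n+1−s} ∈ Der(f_1,…,f_s) be R-linearly independent derivations. Let I ⊆ R be the ideal generated by the (n+1−s)×(n+1−s) minors of the (n+1−s)×n coefficient matrix of δ_1,…,δ_{n+1−s}. Then Der(f_1,…,f_s) = Rδ_1 ⊕ ⋯ ⊕ Rδ_{n+1−s} if and only if the vanishing locus V(I) ⊆ k^n has codimension strictly greater than 1, equivalently the height of the ideal I in R is at least 2. -/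

import Mathlib

open MvPolynomial

/-- The module of logarithmic derivations associated to several polynomials,
`Der(f_1, …, f_s) = {δ ∈ Der_R : f_j·δ(f_i) = f_i·δ(f_j) for all i < j}`, as a submodule
of the module of `k`-linear derivations of `R = k[x_1, …, x_n]`. -/
def logDer {k : Type*} [Field k] {n s : ℕ} (f : Fin s → MvPolynomial (Fin n) k) :
    Submodule (MvPolynomial (Fin n) k)
      (Derivation k (MvPolynomial (Fin n) k) (MvPolynomial (Fin n) k)) where
  carrier := {δ | ∀ i j, i < j → f j * δ (f i) = f i * δ (f j)}
  add_mem' := fun ha hb i j hij => by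
    simp only [Derivation.add_apply, mul_add, ha i j hij, hb i j hij]
  zero_mem' := fun i j _ => by simp
  smul_mem' := fun c δ hδ i j hij => by
    simp only [Derivation.smul_apply, smul_eq_mul]
    rw [mul_left_comm, hδ i j hij, mul_left_comm]

namespace Matrix

/-- A matrix over a field with linearly independent rows has a nonzero maximal minor. -/
theorem exists_det_submatrix_ne_zero_of_field {K : Type*} [Field K] {m n : ℕ}
    (A : Matrix (Fin m) (Fin n) K) (hA : LinearIndependent K A.row) :
    ∃ c : Fin m → Fin n, (A.submatrix id c).det ≠ 0 := by
  have hrank : Module.finrank K (Submodule.span K (Set.range A.col)) = m := by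
    rw [← rank_eq_finrank_span_cols, hA.rank_matrix, Fintype.card_fin]
  obtain ⟨g, hg, -, hli⟩ := Submodule.exists_fun_fin_finrank_span_eq K (Set.range A.col)
  choose c hc using hg
  refine ⟨c ∘ finCongr hrank.symm, ?_⟩
  have hcol : LinearIndependent K (A.submatrix id (c ∘ finCongr hrank.symm)).col := by
    have : (A.submatrix id (c ∘ finCongr hrank.symm)).col = g ∘ finCongr hrank.symm := by
      funext j
      rw [Function.comp_apply, ← hc]
      rfl
    rw [this]
    exact hli.comp _ (finCongr hrank.symm).injective
  exact ((isUnit_iff_isUnit_det _).1 (linearIndependent_cols_iff_isUnit.1 hcol)).ne_zero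

/-- A matrix over a domain with linearly independent rows has a nonzero maximal minor. -/
theorem exists_det_submatrix_ne_zero {D : Type*} [CommRing D] [IsDomain D] {m n : ℕ}
    (A : Matrix (Fin m) (Fin n) D) (hA : LinearIndependent D A.row) :
    ∃ c : Fin m → Fin n, (A.submatrix id c).det ≠ 0 := by
  let K := FractionRing D
  let φ : (Fin n → D) →ₗ[D] (Fin n → K) := (Algebra.linearMap D K).compLeft (Fin n)
  have hφ : LinearMap.ker φ = ⊥ := LinearMap.ker_eq_bot.2 fun v w h =>
    funext fun j => IsFractionRing.injective D K (congrFun h j)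
  have hK : LinearIndependent K (A.map (algebraMap D K)).row :=
    (LinearIndependent.iff_fractionRing D K).1 (hA.map' φ hφ)
  obtain ⟨c, hc⟩ := exists_det_submatrix_ne_zero_of_field _ hK
  refine ⟨c, fun h => hc ?_⟩
  rw [submatrix_map, ← RingHom.mapMatrix_apply, ← RingHom.map_det, h, map_zero]

/-- If all maximal minors of a matrix lie in a prime ideal `P`, then its rows satisfy a linear
relation modulo `P` which is nontrivial modulo `P`. -/
theorem exists_vecMul_mem_of_det_submatrix_mem {R : Type*} [CommRing R] {m n : ℕ}
    (A : Matrix (Fin m) (Fin n) R) (P : Ideal R) [P.IsPrime]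
    (hA : ∀ c : Fin m → Fin n, (A.submatrix id c).det ∈ P) :
    ∃ a : Fin m → R, (∃ i, a i ∉ P) ∧ ∀ j, ∑ i, a i * A i j ∈ P := by
  have hli : ¬ LinearIndependent (R ⧸ P) (A.map (Ideal.Quotient.mk P)).row := by
    intro h
    obtain ⟨c, hc⟩ := exists_det_submatrix_ne_zero _ h
    refine hc ?_
    rw [submatrix_map, ← RingHom.mapMatrix_apply, ← RingHom.map_det]
    exact Ideal.Quotient.eq_zero_iff_mem.2 (hA c)
  rw [Fintype.linearIndependent_iff] at hli
  push Not at hli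
  obtain ⟨g, hg, i, hi⟩ := hli
  choose a ha using fun i => Ideal.Quotient.mk_surjective (g i)
  refine ⟨a, ⟨i, fun h => hi ?_⟩, fun j => ?_⟩
  · rw [← ha, Ideal.Quotient.eq_zero_iff_mem.2 h]
  · rw [← Ideal.Quotient.eq_zero_iff_mem, map_sum]
    simpa [← ha] using congrFun hg j

/-- Cramer's rule as a divisibility statement. -/
theorem dvd_det_mul_of_dvd_vecMul {R : Type*} [CommRing R] {m : ℕ}
    (A : Matrix (Fin m) (Fin m) R) (b : Fin m → R) (r : R)
    (h : ∀ j, r ∣ ∑ i, b i * A i j) (i : Fin m) : r ∣ A.det * b i := by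
  have key : (b ᵥ* A) ᵥ* A.adjugate = A.det • b := by
    rw [vecMul_vecMul, mul_adjugate, vecMul_smul, vecMul_one]
  have hi : A.det * b i = ∑ j, (∑ l, b l * A l j) * A.adjugate j i := (congrFun key i).symm
  rw [hi]
  exact Finset.dvd_sum fun j _ => (h j).mul_right _

end Matrix

theorem Derivation.sum_smul_apply {k R ι : Type*} [CommRing k] [CommRing R] [Algebra k R]
    [Fintype ι] (a : ι → R) (d : ι → Derivation k R R) (x : R) :
    (∑ i, a i • d i) x = ∑ i, a i * d i x := by
  rw [← Derivation.coeFnAddMonoidHom_apply, map_sum, Finset.sum_apply]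
  rfl

/-- A derivation of a domain of characteristic zero which vanishes on a transcendence basis is
zero. -/
theorem Derivation.eq_zero_of_isTranscendenceBasis {k R ι : Type*} [Field k] [CharZero k]
    [CommRing R] [IsDomain R] [Algebra k R] {x : ι → R} (hx : IsTranscendenceBasis k x)
    (d : Derivation k R R) (hd : ∀ i, d (x i) = 0) : d = 0 := by
  have hA : ∀ a ∈ Algebra.adjoin k (Set.range x), d a = 0 := fun a ha =>
    Derivation.eqOn_adjoin (D1 := d) (D2 := 0) (by rintro _ ⟨i, rfl⟩; exact hd i) ha
  have halg := hx.isAlgebraic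
  let A := Algebra.adjoin k (Set.range x)
  let dA : Derivation A R R := Derivation.mk'
    { toFun := d
      map_add' := d.map_add
      map_smul' := fun a r => by
        rw [Algebra.smul_def, d.leibniz, RingHom.id_apply, Algebra.smul_def]
        simp [hA _ a.2, Algebra.smul_def, A] }
    fun a b => d.leibniz a b
  have : CharZero R := charZero_of_injective_algebraMap (algebraMap k R).injective
  have : CharZero A := inferInstance
  ext r
  change dA r = 0
  by_contra hr
  have hker : ∀ N : ℕ, ∀ p : Polynomial A, p.natDegree ≤ N → Polynomial.aeval r p = 0 → p = 0 := by
    intro N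
    induction N with
    | zero =>
      intro p hp h0
      rw [Polynomial.eq_C_of_natDegree_le_zero hp] at h0 ⊢
      rw [Polynomial.aeval_C] at h0
      rw [FaithfulSMul.algebraMap_injective A R (h0.trans (map_zero _).symm), map_zero]
    | succ N ih =>
      intro p hp h0
      have h1 := dA.map_aeval p r
      rw [h0, map_zero, smul_eq_mul, eq_comm, mul_eq_zero, or_iff_left hr] at h1
      have hder := ih _ ((Polynomial.natDegree_derivative_le p).trans (by omega)) h1
      exact ih p ((Polynomial.derivative_eq_zero.1 hder).le.trans
        (Nat.zero_le _)) h0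
  obtain ⟨p, hp, hp0⟩ := halg.isAlgebraic r
  exact hp (hker _ p le_rfl hp0)

/-- Any family of logarithmic derivations along algebraically independent `f_1, …, f_s`, `s ≥ 1`,
with more than `n + 1 - s` members is linearly dependent. -/
theorem not_linearIndependent_of_mem_logDer {k : Type*} [Field k] [CharZero k] {n s : ℕ}
    (hs : 0 < s) (f : Fin s → MvPolynomial (Fin n) k) (hf : AlgebraicIndependent k f)
    {N : ℕ} (hN : n + 1 - s < N)
    (d : Fin N → Derivation k (MvPolynomial (Fin n) k) (MvPolynomial (Fin n) k))
    (hd : ∀ i, d i ∈ logDer f) : ¬ LinearIndependent (MvPolynomial (Fin n) k) d := by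
  intro hli
  let R := MvPolynomial (Fin n) k
  have hinj : Function.Injective f := hf.injective
  obtain ⟨t, hft, ht⟩ := exists_isTranscendenceBasis_superset hf.coe_range
  have hcard : Cardinal.mk t = n := by
    have := ht.lift_cardinalMk_eq_trdeg
    rw [MvPolynomial.trdeg_of_isDomain] at this
    simpa using this
  have hfin : t.Finite := by
    rw [← Cardinal.lt_aleph0_iff_set_finite, hcard]
    exact Cardinal.natCast_lt_aleph0
  have hncard : t.ncard = n := by
    rw [Set.ncard, Set.encard, ENat.card, hcard]; simp
  let u := t \ Set.range f
  have : Fintype u := (hfin.subset Set.sdiff_subset).fintype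
  have hu : Fintype.card u = n - s := by
    rw [← Nat.card_eq_fintype_card, Nat.card_coe_set_eq, Set.ncard_sdiff hft, hncard,
      ← Nat.card_coe_set_eq, Nat.card_range_of_injective hinj, Nat.card_fin]
  have hsn : s ≤ n := by
    rw [← hncard, ← Nat.card_fin s, ← Nat.card_range_of_injective hinj, Nat.card_coe_set_eq]
    exact Set.ncard_le_ncard hft hfin
  let g : Option u → R := fun o => o.elim (f ⟨0, hs⟩) (↑)
  let φ : Derivation k R R →ₗ[R] (Option u → R) :=
    { toFun := fun δ o => δ (g o)
      map_add' := fun _ _ => rfl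
      map_smul' := fun _ _ => rfl }
  have hφ : Disjoint (Submodule.span R (Set.range d)) (LinearMap.ker φ) := by
    rw [Submodule.disjoint_def]
    intro δ hδ hker
    have hδ' : δ ∈ logDer f :=
      Submodule.span_le.2 (by rintro _ ⟨i, rfl⟩; exact hd i) hδ
    have h0 : ∀ o, δ (g o) = 0 := fun o => congrFun (LinearMap.mem_ker.1 hker) o
    have hf0 : δ (f ⟨0, hs⟩) = 0 := h0 none
    refine δ.eq_zero_of_isTranscendenceBasis ht fun x => ?_
    by_cases hx : (x : R) ∈ Set.range f
    · obtain ⟨j, hj⟩ := hx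
      rw [← hj]
      rcases (Nat.zero_le j.1).eq_or_lt with h | h
      · rwa [show j = ⟨0, hs⟩ from Fin.ext h.symm]
      · have := hδ' ⟨0, hs⟩ j h
        rw [hf0, mul_zero] at this
        exact (mul_eq_zero.1 this.symm).resolve_left (hf.ne_zero _)
    · exact h0 (some ⟨x, x.2, hx⟩)
  have hle := (hli.map hφ).fintype_card_le_finrank
  rw [Module.finrank_fintype_fun_eq_card, Fintype.card_option, hu, Fintype.card_fin] at hle
  omega

/-- The relation `2 ≤ height p` fails for every prime generated by a prime element. -/
theorem PrimeSpectrum.not_two_le_height_of_span_singleton {R : Type*} [CommRing R]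
    [IsNoetherianRing R] (p : PrimeSpectrum R) (x : R) (hp : p.asIdeal = Ideal.span {x}) :
    ¬ 2 ≤ Order.height p := by
  have hprime : (Ideal.span {x}).IsPrime := hp ▸ p.isPrime
  have h1 : (Ideal.span {x}).height ≤ 1 :=
    Ideal.height_le_one_of_isPrincipal_of_mem_minimalPrimes (Ideal.span {x}) _
      (by rw [Ideal.minimalPrimes_eq_subsingleton_self]; rfl)
  rw [← hp, PrimeSpectrum.height_eq_orderHeight] at h1
  exact fun h2 => absurd (h2.trans h1) (by norm_num)

/-- In a unique factorization domain, a prime of height at most one is principal. -/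
theorem PrimeSpectrum.exists_eq_span_singleton_of_not_two_le_height {R : Type*} [CommRing R]
    [IsDomain R] [UniqueFactorizationMonoid R] (p : PrimeSpectrum R)
    (hp : ¬ 2 ≤ Order.height p) : ∃ x, p.asIdeal = Ideal.span {x} := by
  by_cases hbot : p.asIdeal = ⊥
  · exact ⟨0, by simp [hbot]⟩
  obtain ⟨x, hxp, hx⟩ := p.isPrime.exists_mem_prime_of_ne_bot hbot
  refine ⟨x, by_contra fun hne => hp ?_⟩
  let q : PrimeSpectrum R := ⟨Ideal.span {x}, (Ideal.span_singleton_prime hx.ne_zero).2 hx⟩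
  have hqp : q < p := lt_of_le_of_ne ((Ideal.span_singleton_le_iff_mem _).2 hxp)
    fun h => hne (congrArg PrimeSpectrum.asIdeal h).symm
  have hbq : (⊥ : PrimeSpectrum R) < q := bot_lt_iff_ne_bot.2 fun h =>
    hx.ne_zero (Ideal.span_singleton_eq_bot.1 (congrArg PrimeSpectrum.asIdeal h))
  exact Order.add_one_le_of_lt (Order.one_lt_height_iff.2 ⟨q, ⊥, hbq, hqp⟩)

/-- Let `I` be an ideal of a Noetherian unique factorization domain such that all primes
containing `I` have height at least two. If `r ∣ x * b` for all `x ∈ I`, then `r ∣ b`. -/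
theorem dvd_of_forall_mem_dvd_mul {R : Type*} [CommRing R] [IsDomain R] [IsNoetherianRing R]
    [UniqueFactorizationMonoid R] {I : Ideal R}
    (hI : ∀ p : PrimeSpectrum R, I ≤ p.asIdeal → 2 ≤ Order.height p) {r b : R} (hr : r ≠ 0)
    (h : ∀ x ∈ I, r ∣ x * b) : r ∣ b := by
  obtain ⟨r', b', c, hrel, rfl, rfl⟩ := UniqueFactorizationMonoid.exists_reduced_factors r hr b
  obtain ⟨hc, hr'⟩ := mul_ne_zero_iff.1 hr
  refine mul_dvd_mul_left c (IsUnit.dvd ?_)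
  by_contra hunit
  obtain ⟨π, hπ, hπr⟩ := WfDvdMonoid.exists_irreducible_factor hunit hr'
  let p : PrimeSpectrum R := ⟨Ideal.span {π}, (Ideal.span_singleton_prime hπ.ne_zero).2 hπ.prime⟩
  refine p.not_two_le_height_of_span_singleton π rfl (hI p fun x hx => ?_)
  have hrx := h x hx
  rw [mul_left_comm] at hrx
  exact Ideal.mem_span_singleton.2
    (hπr.trans (hrel.dvd_of_dvd_mul_right ((mul_dvd_mul_iff_left hc).1 hrx)))

/-- **Saito criterion for several polynomials.** Let `f_1, …, f_s ∈ R = k[x_1, …, x_n]`,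
`1 < s ≤ n − 1`, be algebraically independent over the field `k` of characteristic zero,
and let `δ_1, …, δ_{n+1−s} ∈ Der(f_1, …, f_s)` be `R`-linearly independent derivations.
Let `I` be the ideal generated by the `(n+1−s) × (n+1−s)` minors of the coefficient matrix
`(δ_i(x_j))`. Then `Der(f_1, …, f_s) = Rδ_1 ⊕ ⋯ ⊕ Rδ_{n+1−s}` if and only if the vanishing
locus `V(I)` has codimension `> 1`, i.e. every prime of `R` containing `I` has height at
least `2`. -/
theorem saito_criterion_several_polynomials {k : Type*} [Field k] [CharZero k] {n s : ℕ}
    (hs : 1 < s) (hsn : s ≤ n - 1) (f : Fin s → MvPolynomial (Fin n) k)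
    (hf : AlgebraicIndependent k f)
    (δ : Fin (n + 1 - s) → Derivation k (MvPolynomial (Fin n) k) (MvPolynomial (Fin n) k))
    (hδ : ∀ i, δ i ∈ logDer f)
    (hind : LinearIndependent (MvPolynomial (Fin n) k) δ)
    (I : Ideal (MvPolynomial (Fin n) k))
    (hI : I = Ideal.span
      {x | ∃ c : Fin (n + 1 - s) → Fin n,
        x = Matrix.det ((Matrix.of fun i j => δ i (X j)).submatrix id c)}) :
    Submodule.span (MvPolynomial (Fin n) k) (Set.range δ) = logDer f ↔
      ∀ p : PrimeSpectrum (MvPolynomial (Fin n) k), I ≤ p.asIdeal →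
        2 ≤ Order.height p := by
  have hminor : ∀ c : Fin (n + 1 - s) → Fin n,
      ((Matrix.of fun i j => δ i (X j)).submatrix id c).det ∈ I := fun c => by
    rw [hI]; exact Ideal.subset_span ⟨c, rfl⟩
  have hspan : Submodule.span (MvPolynomial (Fin n) k) (Set.range δ) ≤ logDer f :=
    Submodule.span_le.2 (by rintro _ ⟨i, rfl⟩; exact hδ i)
  constructor
  · intro heq p hIp
    by_contra hht
    obtain ⟨π, hπ⟩ : ∃ π, p.asIdeal = Ideal.span {π} :=
      p.exists_eq_span_singleton_of_not_two_le_height hht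
    obtain ⟨a, ⟨i, hi⟩, ha⟩ :=
      (Matrix.of fun i j => δ i (X j)).exists_vecMul_mem_of_det_submatrix_mem p.asIdeal
        fun c => hIp (hminor c)
    simp only [hπ, Ideal.mem_span_singleton] at hi ha
    choose q hq using ha
    let θ : Derivation k (MvPolynomial (Fin n) k) (MvPolynomial (Fin n) k) := mkDerivation k q
    have hθ : ∑ i, a i • δ i = π • θ := derivation_ext fun j => by
      simpa [θ, Derivation.sum_smul_apply] using hq j
    have hπ0 : π ≠ 0 := by
      rintro rfl
      rw [zero_smul] at hθ
      exact hi (by rw [Fintype.linearIndependent_iff.1 hind a hθ i])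
    have hθmem : θ ∈ logDer f := fun i j hij => by
      have h := (logDer f).sum_mem (fun i (_ : i ∈ Finset.univ) =>
        (logDer f).smul_mem (a i) (hδ i))
      rw [hθ] at h
      have h' := h i j hij
      simp only [Derivation.smul_apply, smul_eq_mul, mul_left_comm _ π] at h'
      exact mul_left_cancel₀ hπ0 h'
    rw [← heq, Submodule.mem_span_range_iff_exists_fun] at hθmem
    obtain ⟨b, hb⟩ := hθmem
    have hrel : ∑ i, (a i - π * b i) • δ i = 0 := by
      refine derivation_ext fun j => ?_
      have hj := congrArg (fun d => d (X j)) (hθ.trans (congrArg (π • ·) hb.symm))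
      simpa [Derivation.sum_smul_apply, sub_mul, mul_assoc, Finset.mul_sum, sub_eq_zero] using hj
    exact hi ⟨b i, sub_eq_zero.1 (Fintype.linearIndependent_iff.1 hind _ hrel i)⟩
  · intro hcodim
    refine le_antisymm hspan fun θ hθ => ?_
    have hdep := not_linearIndependent_of_mem_logDer (by omega) f hf (Nat.lt_succ_self _)
      (Fin.cons θ δ : Fin (n + 1 - s + 1) → _) (Fin.cases hθ hδ)
    have hex : ∃ r : MvPolynomial (Fin n) k, r ≠ 0 ∧
        r • θ ∈ Submodule.span (MvPolynomial (Fin n) k) (Set.range δ) := by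
      by_contra! h
      refine hdep (hind.finCons' θ δ fun r y hy hr => ?_)
      by_contra hr0
      refine h r hr0 ?_
      rw [eq_neg_of_add_eq_zero_left hr]
      exact Submodule.neg_mem _ hy
    obtain ⟨r, hr0, hr⟩ := hex
    obtain ⟨b, hb⟩ := (Submodule.mem_span_range_iff_exists_fun _).1 hr
    have hdvd : ∀ i, r ∣ b i := fun i => by
      refine dvd_of_forall_mem_dvd_mul hcodim hr0 fun x hx => ?_
      rw [hI] at hx
      induction hx using Submodule.span_induction with
      | mem x hx =>
        obtain ⟨c, rfl⟩ := hx
        refine Matrix.dvd_det_mul_of_dvd_vecMul _ b r (fun j => ⟨θ (X (c j)), ?_⟩) i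
        simpa [Derivation.sum_smul_apply] using congrArg (fun d => d (X (c j))) hb
      | zero => simp
      | add x y _ _ hx hy => rw [add_mul]; exact hx.add hy
      | smul a x _ hx => rw [smul_eq_mul, mul_assoc]; exact hx.mul_left a
    choose e he using hdvd
    refine (Submodule.mem_span_range_iff_exists_fun _).2 ⟨e, ?_⟩
    have hre : r • ∑ i, e i • δ i = r • θ := by
      rw [← hb, Finset.smul_sum]
      exact Finset.sum_congr rfl fun i _ => by rw [smul_smul, ← he]
    refine derivation_ext fun j => ?_
    exact mul_left_cancel₀ hr0 (congrArg (fun d => d (X j)) hre)
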